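/- arXiv:1905.06959 — 2 statements merged into one kernel-verified Lean document; each statement's English description precedes it below -/
import Mathlib

section
/- Let X be a finite set and let R_0, …, R_d be relations on X forming a symmetric association scheme (R_0 the identity relation, the R_i partitioning X × X, each R_i symmetric, and with well-defined intersection numbers p^k_{ij}). Let Γ be the simple graph on X whose edges are the pairs in R_1, and assume Γ is connected. If there exists a set T ⊆ X with |T| = 2 such that the induced subgraph of Γ on X ∖ T is disconnected, then Γ is isomorphic to a cycle graph. -/
open Finset RealInnerProductSpace

theorem SimpleGraph.Connected.mem_of_adj_closed {V : Type*} {G : SimpleGraph V}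
    (hG : G.Connected) {S : Set V} (hS : S.Nonempty)
    (hadj : ∀ v ∈ S, ∀ w, G.Adj v w → w ∈ S) (w : V) : w ∈ S := by
  obtain ⟨v, hv⟩ := hS
  obtain ⟨p⟩ := hG.preconnected v w
  induction p with
  | nil => exact hv
  | cons h p ih => exact ih (hadj _ hv _ h)

theorem SimpleGraph.Connected.nonempty_iso_cycleGraph {V : Type*} [Fintype V]
    {G : SimpleGraph V} [DecidableRel G.Adj] (hG : G.Connected)
    (hreg : G.IsRegularOfDegree 2) :
    ∃ n : ℕ, Nonempty (G ≃g SimpleGraph.cycleGraph n) := by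
  classical
  obtain ⟨v⟩ := hG.nonempty
  have hcyc : G.IsCycles := fun w _ => by
    rw [← G.coe_neighborFinset w, Set.ncard_coe_finset, G.card_neighborFinset_eq_degree, hreg w]
  have hne : (G.neighborSet v).Nonempty := by
    apply Set.nonempty_of_ncard_ne_zero
    rw [← G.coe_neighborFinset v, Set.ncard_coe_finset, G.card_neighborFinset_eq_degree, hreg v]
    norm_num
  obtain ⟨p, hp, -⟩ := hcyc.exists_cycle_toSubgraph_verts_eq_connectedComponentSupp
    (c := G.connectedComponentMk v) rfl hne
  have hlen : 2 < p.length := hp.three_le_length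
  obtain ⟨f⟩ := (SimpleGraph.cycleGraph_isContained_iff hlen).2 ⟨v, p, hp, rfl⟩
  generalize p.length = n at hlen f
  obtain ⟨m, rfl⟩ : ∃ m, n = m + 3 := ⟨n - 3, by omega⟩
  have hinj : Function.Injective (f : Fin (m + 3) → V) := f.injective
  have himage : ∀ i, ((SimpleGraph.cycleGraph (m + 3)).neighborFinset i).image f
      = G.neighborFinset (f i) := fun i => by
    apply Finset.eq_of_subset_of_card_le
    · intro w hw
      obtain ⟨j, hj, rfl⟩ := Finset.mem_image.1 hw
      rw [SimpleGraph.mem_neighborFinset] at hj ⊢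
      exact f.toHom.map_adj hj
    · rw [Finset.card_image_of_injective _ hinj, G.card_neighborFinset_eq_degree, hreg,
        SimpleGraph.card_neighborFinset_eq_degree, SimpleGraph.cycleGraph_degree_three_le]
  have hsurj : Function.Surjective f := by
    refine hG.mem_of_adj_closed (S := Set.range f) ⟨f 0, 0, rfl⟩ ?_
    rintro _ ⟨i, rfl⟩ w hw
    rw [← SimpleGraph.mem_neighborFinset, ← himage] at hw
    obtain ⟨j, -, rfl⟩ := Finset.mem_image.1 hw
    exact ⟨j, rfl⟩
  refine ⟨m + 3, ⟨SimpleGraph.Iso.symm ⟨Equiv.ofBijective f ⟨hinj, hsurj⟩, ?_⟩⟩⟩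
  intro i j
  refine ⟨fun h => ?_, fun h => f.toHom.map_adj h⟩
  have h' : f j ∈ G.neighborFinset (f i) := (SimpleGraph.mem_neighborFinset _ _ _).2 h
  rw [← himage] at h'
  obtain ⟨l, hl, hlj⟩ := Finset.mem_image.1 h'
  rw [hinj hlj] at hl
  exact (SimpleGraph.mem_neighborFinset _ _ _).1 hl

/-- Matrices whose entries are functions of the colour `c x y` of their position, for a colouring
`c` with well-defined intersection numbers. -/
def colourSubalgebra {X ι : Type*} [Fintype X] [DecidableEq X] [Fintype ι] [DecidableEq ι]
    (c : X → X → ι) (i₀ : ι) (hc : ∀ x y, c x y = i₀ ↔ x = y) (p : ι → ι → ι → ℕ)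
    (hp : ∀ i j x y, #{z | c x z = i ∧ c z y = j} = p i j (c x y)) :
    Subalgebra ℝ (Matrix X X ℝ) where
  carrier := {M | ∃ m : ι → ℝ, ∀ x y, M x y = m (c x y)}
  add_mem' := by
    rintro M N ⟨m, hm⟩ ⟨n, hn⟩
    exact ⟨m + n, fun x y => by simp [hm, hn]⟩
  mul_mem' := by
    rintro M N ⟨m, hm⟩ ⟨n, hn⟩
    refine ⟨fun k => ∑ ij : ι × ι, p ij.1 ij.2 k * (m ij.1 * n ij.2), fun x y => ?_⟩
    simp only [Matrix.mul_apply, hm, hn]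
    rw [← Finset.sum_fiberwise' univ (fun z => (c x z, c z y)) (fun ij => m ij.1 * n ij.2)]
    refine Finset.sum_congr rfl fun ij _ => ?_
    rw [Finset.sum_const, nsmul_eq_mul, ← hp]
    simp [Prod.ext_iff]
  algebraMap_mem' := by
    intro r
    refine ⟨fun i => if i = i₀ then r else 0, fun x y => ?_⟩
    simp [Matrix.algebraMap_matrix_apply, hc]

theorem Matrix.IsHermitian.exists_top_eigenvalue {X : Type*} [Fintype X] [DecidableEq X]
    [Nonempty X] {B : Matrix X X ℝ} (hB : B.IsHermitian) :
    ∃ r : ℝ, (r • (1 : Matrix X X ℝ) - B).PosSemidef ∧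
      ∃ q : Polynomial ℝ, Polynomial.aeval B q ≠ 0 ∧
        B * Polynomial.aeval B q = r • Polynomial.aeval B q := by
  obtain ⟨i, hi⟩ := Finite.exists_max hB.eigenvalues
  refine ⟨hB.eigenvalues i, ?_, ?_⟩
  · have hH : (hB.eigenvalues i • (1 : Matrix X X ℝ) - B).IsHermitian :=
      (Matrix.isHermitian_one.smul (by simp [IsSelfAdjoint])).sub hB
    rw [hH.posSemidef_iff_eigenvalues_nonneg]
    intro j
    have hj : hH.eigenvalues j ∈ spectrum ℝ (hB.eigenvalues i • (1 : Matrix X X ℝ) - B) := by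
      rw [hH.spectrum_real_eq_range_eigenvalues]; exact ⟨j, rfl⟩
    rw [Pi.zero_apply]
    generalize hH.eigenvalues j = t at hj ⊢
    rw [← Algebra.algebraMap_eq_smul_one, ← spectrum.singleton_sub_eq,
      hB.spectrum_real_eq_range_eigenvalues] at hj
    obtain ⟨_, rfl, _, ⟨l, rfl⟩, rfl⟩ := hj
    simpa using hi l
  · have hroot : (minpoly ℝ B).IsRoot (hB.eigenvalues i) := by
      rw [← Matrix.minpoly_toLin']
      apply Module.End.isRoot_of_hasEigenvalue
      rw [Module.End.hasEigenvalue_iff_mem_spectrum, Matrix.spectrum_toLin',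
        hB.spectrum_real_eq_range_eigenvalues]
      exact ⟨i, rfl⟩
    obtain ⟨q, hq⟩ := Polynomial.dvd_iff_isRoot.2 hroot
    have hint : IsIntegral ℝ B := Algebra.IsIntegral.isIntegral B
    have hq0 : q ≠ 0 := by
      rintro rfl
      exact minpoly.ne_zero hint (by simpa using hq)
    refine ⟨q, fun h => ?_, ?_⟩
    · have h1 := minpoly.degree_le_of_ne_zero ℝ B hq0 h
      rw [hq, Polynomial.degree_mul, Polynomial.degree_X_sub_C,
        Polynomial.degree_eq_natDegree hq0] at h1
      norm_cast at h1
      omega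
    · have h := minpoly.aeval ℝ B
      rw [hq, map_mul, map_sub, Polynomial.aeval_X, Polynomial.aeval_C, sub_mul, sub_eq_zero,
        Algebra.algebraMap_eq_smul_one, smul_mul_assoc, one_mul] at h
      exact h

section Plane

variable {E : Type*} [NormedAddCommGroup E] [InnerProductSpace ℝ E]

theorem Submodule.exists_inner_pos_of_notMem {P : Submodule ℝ E} [P.HasOrthogonalProjection]
    {v : E} (hv : v ∉ P) : ∃ w : E, (∀ z ∈ P, ⟪w, z⟫ = 0) ∧ 0 < ⟪w, v⟫ := by
  have horth : ∀ z ∈ P, ⟪v - P.starProjection v, z⟫ = 0 := fun z hz =>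
    (Submodule.mem_orthogonal' P _).1 (P.sub_starProjection_mem_orthogonal v) z hz
  refine ⟨v - P.starProjection v, horth, ?_⟩
  have hne : v - P.starProjection v ≠ 0 := fun h => hv <| by
    rw [sub_eq_zero.1 h]; exact P.starProjection_apply_mem v
  have h := real_inner_self_pos.2 hne
  rwa [inner_sub_right, horth _ (P.starProjection_apply_mem v), sub_zero] at h

theorem eq_or_eq_neg_of_mem_span_pair {a b v w w' : E} (hv : v ≠ 0)
    (hvP : v ∈ Submodule.span ℝ {a, b}) (hwP : w ∈ Submodule.span ℝ {a, b})
    (hwP' : w' ∈ Submodule.span ℝ {a, b}) (hw : ⟪v, w⟫ = 0) (hw' : ⟪v, w'⟫ = 0)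
    (hnorm : ⟪w', w'⟫ = ⟪w, w⟫) : w' = w ∨ w' = -w := by
  classical
  by_cases hw0 : w = 0
  · subst hw0
    left
    rw [inner_zero_left] at hnorm
    exact inner_self_eq_zero.1 hnorm
  have hind : LinearIndependent ℝ ![v, w] := by
    apply linearIndependent_of_ne_zero_of_inner_eq_zero
    · intro i; fin_cases i <;> simpa
    · intro i j hij
      fin_cases i <;> fin_cases j <;> simp_all [real_inner_comm]
  have : FiniteDimensional ℝ (Submodule.span ℝ {a, b}) :=
    FiniteDimensional.span_of_finite ℝ (Set.toFinite _)
  have hspan : Submodule.span ℝ {v, w} = Submodule.span ℝ {a, b} := by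
    apply Submodule.eq_of_le_of_finrank_le
    · rw [Submodule.span_le]
      rintro z (rfl | rfl) <;> assumption
    · have h1 := finrank_span_eq_card hind
      rw [Matrix.range_cons_cons_empty] at h1
      rw [h1, Fintype.card_fin]
      have h2 := finrank_span_finset_le_card (R := ℝ) ({a, b} : Finset E)
      rw [Finset.coe_pair] at h2
      exact h2.trans Finset.card_le_two
  rw [← hspan, Submodule.mem_span_pair] at hwP'
  obtain ⟨r, s, rfl⟩ := hwP'
  have hvv := real_inner_self_pos.2 hv
  have hww := real_inner_self_pos.2 hw0
  have hr : r = 0 := by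
    simp only [inner_add_right, real_inner_smul_right, hw] at hw'
    simpa [hv] using hw'
  subst hr
  simp only [zero_smul, zero_add, real_inner_smul_left, real_inner_smul_right] at hnorm ⊢
  have hs : s ^ 2 = 1 := by
    apply mul_right_cancel₀ hww.ne'
    linarith
  rcases eq_or_eq_neg_of_sq_eq_sq s 1 (by rw [hs, one_pow]) with rfl | rfl
  · left; simp
  · right; simp

end Plane

section Separation

variable {X : Type*}

/-- `C` and `D` are disjoint from each other and from `{x, y}`, and every neighbour of a vertex of
`C` (of `D`) lies in `C` (in `D`) or in `{x, y}`. -/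
structure SimpleGraph.Separates (Γ : SimpleGraph X) (x y : X) (C D : Finset X) : Prop where
  disjoint : Disjoint C D
  left_notMem_left : x ∉ C
  right_notMem_left : y ∉ C
  left_notMem_right : x ∉ D
  right_notMem_right : y ∉ D
  adj_left : ∀ v ∈ C, ∀ w, Γ.Adj v w → w ∈ C ∨ w = x ∨ w = y
  adj_right : ∀ v ∈ D, ∀ w, Γ.Adj v w → w ∈ D ∨ w = x ∨ w = y

theorem SimpleGraph.Separates.symm {Γ : SimpleGraph X} {x y : X} {C D : Finset X}
    (h : Γ.Separates x y C D) : Γ.Separates x y D C :=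
  ⟨h.disjoint.symm, h.left_notMem_right, h.right_notMem_right, h.left_notMem_left,
    h.right_notMem_left, h.adj_right, h.adj_left⟩

variable [Fintype X] [DecidableEq X] {Γ : SimpleGraph X} [DecidableRel Γ.Adj] {x y : X}
  {C D : Finset X}

theorem SimpleGraph.Separates.le_posPart_of_adj (hsep : Γ.Separates x y C D) {h : X → ℝ}
    (hx : h x ≤ 0) (hy : h y ≤ 0)
    {v : X} (hv : v ∈ C) :
    ∀ n ∈ Γ.neighborFinset v, h n ≤ if n ∈ C then max (h n) 0 else 0 := by
  intro n hn
  rw [SimpleGraph.mem_neighborFinset] at hn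
  rcases hsep.adj_left v hv n hn with hC | rfl | rfl
  · simp [hC]
  · simpa [hsep.left_notMem_left] using hx
  · simpa [hsep.right_notMem_left] using hy

theorem SimpleGraph.Separates.pos_of_adj (hsep : Γ.Separates x y C D) {μ : ℝ}
    (hray : ∀ f : X → ℝ, ∑ v, f v = 0 →
      (∀ v, μ * f v ^ 2 ≤ f v * ∑ n ∈ Γ.neighborFinset v, f n) →
      ∀ v, ∑ n ∈ Γ.neighborFinset v, f n = μ * f v)
    {h₁ h₂ : X → ℝ} (heig₁ : ∀ v, ∑ n ∈ Γ.neighborFinset v, h₁ n = μ * h₁ v)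
    (heig₂ : ∀ v, ∑ n ∈ Γ.neighborFinset v, h₂ n = μ * h₂ v)
    (hx₁ : h₁ x ≤ 0) (hy₁ : h₁ y ≤ 0) (hx₂ : h₂ x ≤ 0) (hy₂ : h₂ y ≤ 0)
    (hD : ∃ d ∈ D, 0 < h₂ d) {v w : X} (hv : v ∈ C) (hpos : 0 < h₁ v) (hvw : Γ.Adj v w) :
    (w ∈ C ∧ 0 < h₁ w) ∨ ((w = x ∨ w = y) ∧ h₁ w = 0) := by
  set f₁ : X → ℝ := fun n => if n ∈ C then max (h₁ n) 0 else 0 with hf₁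
  set f₂ : X → ℝ := fun n => if n ∈ D then max (h₂ n) 0 else 0 with hf₂
  have hf₁0 : ∀ n, 0 ≤ f₁ n := fun n => by simp only [hf₁]; split_ifs <;> simp
  have hf₂0 : ∀ n, 0 ≤ f₂ n := fun n => by simp only [hf₂]; split_ifs <;> simp
  have hle₁ : ∀ c ∈ C, ∀ n ∈ Γ.neighborFinset c, h₁ n ≤ f₁ n := fun c hc =>
    hsep.le_posPart_of_adj hx₁ hy₁ hc
  have hle₂ : ∀ c ∈ D, ∀ n ∈ Γ.neighborFinset c, h₂ n ≤ f₂ n := fun c hc =>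
    hsep.symm.le_posPart_of_adj hx₂ hy₂ hc
  have hs₁ : 0 < ∑ n, f₁ n :=
    Finset.sum_pos' (fun n _ => hf₁0 n) ⟨v, mem_univ _, by simp [hf₁, hv, hpos]⟩
  have hs₂ : 0 < ∑ n, f₂ n := by
    obtain ⟨d, hd, hd0⟩ := hD
    exact Finset.sum_pos' (fun n _ => hf₂0 n) ⟨d, mem_univ _, by simp [hf₂, hd, hd0]⟩
  set s₁ := ∑ n, f₁ n
  set s₂ := ∑ n, f₂ n
  have hCD : ∀ c ∈ C, c ∉ D := fun c hc hd => (Finset.disjoint_left.1 hsep.disjoint) hc hd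
  have hsub₁ : ∀ c ∈ C, μ * f₁ c ^ 2 ≤ f₁ c * ∑ n ∈ Γ.neighborFinset c, f₁ n := by
    intro c hc
    rcases (hf₁0 c).eq_or_lt with h0 | h0
    · simp [← h0]
    have hfc : f₁ c = h₁ c := by
      simp only [hf₁, hc, if_true] at h0 ⊢
      exact max_eq_left_of_lt (by simpa using h0)
    have := Finset.sum_le_sum (hle₁ c hc)
    rw [heig₁, ← hfc] at this
    nlinarith
  have hsub₂ : ∀ c ∈ D, μ * f₂ c ^ 2 ≤ f₂ c * ∑ n ∈ Γ.neighborFinset c, f₂ n := by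
    intro c hc
    rcases (hf₂0 c).eq_or_lt with h0 | h0
    · simp [← h0]
    have hfc : f₂ c = h₂ c := by
      simp only [hf₂, hc, if_true] at h0 ⊢
      exact max_eq_left_of_lt (by simpa using h0)
    have := Finset.sum_le_sum (hle₂ c hc)
    rw [heig₂, ← hfc] at this
    nlinarith
  have hzero₂ : ∀ c ∈ C, ∑ n ∈ Γ.neighborFinset c, f₂ n = 0 := by
    intro c hc
    refine Finset.sum_eq_zero fun n hn => ?_
    rw [SimpleGraph.mem_neighborFinset] at hn
    rcases hsep.adj_left c hc n hn with h | rfl | rfl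
    · simp [hf₂, hCD n h]
    · simp [hf₂, hsep.left_notMem_right]
    · simp [hf₂, hsep.right_notMem_right]
  have hzero₁ : ∀ c ∈ D, ∑ n ∈ Γ.neighborFinset c, f₁ n = 0 := by
    intro c hc
    refine Finset.sum_eq_zero fun n hn => ?_
    rw [SimpleGraph.mem_neighborFinset] at hn
    rcases hsep.adj_right c hc n hn with h | rfl | rfl
    · have : n ∉ C := fun hC => hCD n hC h
      simp [hf₁, this]
    · simp [hf₁, hsep.left_notMem_left]
    · simp [hf₁, hsep.right_notMem_left]
  have heig := hray (fun n => s₂ * f₁ n - s₁ * f₂ n)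
    (by rw [Finset.sum_sub_distrib, ← Finset.mul_sum, ← Finset.mul_sum]; ring)
    (fun c => by
      rw [Finset.sum_sub_distrib, ← Finset.mul_sum, ← Finset.mul_sum]
      by_cases hcC : c ∈ C
      · have hc0 : f₂ c = 0 := by simp [hf₂, hCD c hcC]
        rw [hc0, hzero₂ c hcC]
        nlinarith [mul_le_mul_of_nonneg_left (hsub₁ c hcC) (sq_nonneg s₂)]
      · have hc0 : f₁ c = 0 := by simp [hf₁, hcC]
        by_cases hcD : c ∈ D
        · rw [hc0, hzero₁ c hcD]
          nlinarith [mul_le_mul_of_nonneg_left (hsub₂ c hcD) (sq_nonneg s₁)]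
        · have hc0' : f₂ c = 0 := by simp [hf₂, hcD]
          simp [hc0, hc0'])
  have heig' : ∀ c ∈ C, ∑ n ∈ Γ.neighborFinset c, f₁ n = μ * f₁ c := by
    intro c hc
    have h := heig c
    have hc0 : f₂ c = 0 := by simp [hf₂, hCD c hc]
    rw [Finset.sum_sub_distrib, ← Finset.mul_sum, ← Finset.mul_sum, hzero₂ c hc, hc0] at h
    apply mul_left_cancel₀ hs₂.ne'
    linarith
  have hfv : f₁ v = h₁ v := by simp [hf₁, hv, hpos.le]
  have hmem : w ∈ Γ.neighborFinset v := (SimpleGraph.mem_neighborFinset _ _ _).2 hvw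
  by_cases hwC : w ∈ C
  · left
    refine ⟨hwC, ?_⟩
    by_contra hneg
    have hw0 : f₁ w = 0 := by simpa [hf₁, hwC] using hneg
    have hsum := heig' w hwC
    rw [hw0, mul_zero, Finset.sum_eq_zero_iff_of_nonneg fun n _ => hf₁0 n] at hsum
    have := hsum v ((SimpleGraph.mem_neighborFinset _ _ _).2 hvw.symm)
    linarith
  · right
    refine ⟨(hsep.adj_left v hv w hvw).resolve_left hwC, ?_⟩
    have hsum : ∑ n ∈ Γ.neighborFinset v, h₁ n = ∑ n ∈ Γ.neighborFinset v, f₁ n := by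
      rw [heig₁, heig' v hv, hfv]
    rw [(Finset.sum_eq_sum_iff_of_le (hle₁ v hv)).1 hsum w hmem]
    simp [hf₁, hwC]

end Separation

/-- A representation of a graph by vectors of constant norm and constant inner product along edges
whose coordinates are eigenfunctions for the largest eigenvalue of the adjacency operator on
functions with sum zero. -/
structure SimpleGraph.TopRepresentation {X : Type*} [Fintype X] (Γ : SimpleGraph X)
    [DecidableRel Γ.Adj] (E : Type*) [NormedAddCommGroup E] [InnerProductSpace ℝ E] where
  vec : X → E
  normSq : ℝ
  edgeInner : ℝ
  eigenvalue : ℝ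
  inner_self : ∀ v, ⟪vec v, vec v⟫ = normSq
  inner_adj : ∀ v w, Γ.Adj v w → ⟪vec v, vec w⟫ = edgeInner
  edgeInner_nonneg : 0 ≤ edgeInner
  edgeInner_lt : edgeInner < normSq
  sum_neighbor : ∀ v, ∑ n ∈ Γ.neighborFinset v, vec n = eigenvalue • vec v
  rayleigh : ∀ f : X → ℝ, ∑ v, f v = 0 →
    (∀ v, eigenvalue * f v ^ 2 ≤ f v * ∑ n ∈ Γ.neighborFinset v, f n) →
    ∀ v, ∑ n ∈ Γ.neighborFinset v, f n = eigenvalue * f v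

namespace SimpleGraph.TopRepresentation

variable {X : Type*} [Fintype X] {Γ : SimpleGraph X} [DecidableRel Γ.Adj]
  {E : Type*} [NormedAddCommGroup E] [InnerProductSpace ℝ E]
  (ρ : Γ.TopRepresentation E)

theorem normSq_pos : 0 < ρ.normSq := ρ.edgeInner_nonneg.trans_lt ρ.edgeInner_lt

theorem vec_ne_zero (v : X) : ρ.vec v ≠ 0 := by
  rw [← real_inner_self_pos, ρ.inner_self]; exact ρ.normSq_pos

theorem sum_inner (h : E) (v : X) :
    ∑ n ∈ Γ.neighborFinset v, ⟪h, ρ.vec n⟫ = ρ.eigenvalue * ⟪h, ρ.vec v⟫ := by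
  rw [← inner_sum, ρ.sum_neighbor, real_inner_smul_right]

/-- Adjacent vertices are not represented on a common line. -/
theorem not_mem_span_singleton {v w : X} (hvw : Γ.Adj v w) {z : E}
    (hv : ρ.vec v ∈ Submodule.span ℝ {z}) : ρ.vec w ∉ Submodule.span ℝ {z} := by
  intro hw
  obtain ⟨a, ha⟩ := Submodule.mem_span_singleton.1 hv
  obtain ⟨b, hb⟩ := Submodule.mem_span_singleton.1 hw
  have h1 := ρ.inner_self v
  have h2 := ρ.inner_self w
  have h3 := ρ.inner_adj v w hvw
  simp only [← ha, ← hb, real_inner_smul_left, real_inner_smul_right] at h1 h2 h3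
  have h4 : ρ.edgeInner * ρ.edgeInner = ρ.normSq * ρ.normSq := by
    calc ρ.edgeInner * ρ.edgeInner = a * (a * ⟪z, z⟫) * (b * (b * ⟪z, z⟫)) := by rw [← h3]; ring
      _ = ρ.normSq * ρ.normSq := by rw [h1, h2]
  nlinarith [ρ.edgeInner_nonneg, ρ.edgeInner_lt]

/-- A set of vertices closed under adjacency up to two distinctly represented vertices, locally
planar and represented in an open half-space, forces valency at most two. -/
theorem le_two_of_locally_planar {k : ℕ} (hreg : Γ.IsRegularOfDegree k) {x y : X}
    (hxy : ρ.vec x ≠ ρ.vec y) {S : Finset X} (hS : S.Nonempty)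
    (hadj : ∀ d ∈ S, ∀ n, Γ.Adj d n → n ∈ S ∨ n = x ∨ n = y)
    {g : E} (hg : ∀ d ∈ S, 0 < ⟪g, ρ.vec d⟫)
    (hplane : ∀ d ∈ S, ∃ a b : E, ρ.vec d ∈ Submodule.span ℝ {a, b} ∧
      ∀ n, Γ.Adj d n → ρ.vec n ∈ Submodule.span ℝ {a, b}) : k ≤ 2 := by
  by_contra! hk
  obtain ⟨d, hd, hmin⟩ := Finset.exists_min_image S (fun d => ⟪g, ρ.vec d⟫) hS
  obtain ⟨a, b, hdP, hnP⟩ := hplane d hd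
  have hq := ρ.normSq_pos
  set c := ρ.edgeInner / ρ.normSq
  have hcq : c * ρ.normSq = ρ.edgeInner := div_mul_cancel₀ _ hq.ne'
  have hc1 : c < 1 := (div_lt_one hq).2 ρ.edgeInner_lt
  have hc0 : 0 ≤ c := div_nonneg ρ.edgeInner_nonneg hq.le
  set w : X → E := fun n => ρ.vec n - c • ρ.vec d with hw
  have hcard : #(Γ.neighborFinset d) = k := by
    rw [Γ.card_neighborFinset_eq_degree, hreg d]
  have horth : ∀ n ∈ Γ.neighborFinset d, ⟪ρ.vec d, w n⟫ = 0 := fun n hn => by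
    rw [Γ.mem_neighborFinset] at hn
    simp only [hw, inner_sub_right, real_inner_smul_right, ρ.inner_self, ρ.inner_adj d n hn, hcq,
      sub_self]
  have hnorm : ∀ n ∈ Γ.neighborFinset d, ⟪w n, w n⟫ = ρ.normSq - c * ρ.edgeInner := fun n hn => by
    have h0 := horth n hn
    rw [Γ.mem_neighborFinset] at hn
    nth_rw 1 [hw]
    rw [inner_sub_left, real_inner_smul_left, h0]
    simp only [hw, inner_sub_right, real_inner_smul_right, ρ.inner_self,
      ρ.inner_adj n d hn.symm]
    ring
  have hnpos : 0 < ρ.normSq - c * ρ.edgeInner := by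
    nlinarith [ρ.edgeInner_lt, ρ.edgeInner_nonneg]
  have hmemP : ∀ n ∈ Γ.neighborFinset d, w n ∈ Submodule.span ℝ {a, b} := fun n hn =>
    Submodule.sub_mem _ (hnP n ((Γ.mem_neighborFinset _ _).1 hn)) (Submodule.smul_mem _ _ hdP)
  have hsum : ∑ n ∈ Γ.neighborFinset d, w n = 0 := by
    have h1 : ∑ n ∈ Γ.neighborFinset d, w n = (ρ.eigenvalue - k * c) • ρ.vec d := by
      simp only [hw, Finset.sum_sub_distrib, ρ.sum_neighbor, Finset.sum_const, hcard, sub_smul,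
        mul_smul, Nat.cast_smul_eq_nsmul]
    have h2 : ⟪ρ.vec d, ∑ n ∈ Γ.neighborFinset d, w n⟫ = 0 := by
      rw [inner_sum]; exact Finset.sum_eq_zero horth
    rw [h1, real_inner_smul_right, ρ.inner_self, mul_eq_zero, or_iff_left hq.ne'] at h2
    rw [h1, h2, zero_smul]
  obtain ⟨n₀, hn₀⟩ : (Γ.neighborFinset d).Nonempty := Finset.card_pos.1 (by omega)
  have hw0 : w n₀ ≠ 0 := by
    rw [← real_inner_self_pos, hnorm n₀ hn₀]; exact hnpos
  classical
  set P := (Γ.neighborFinset d).filter fun n => w n = w n₀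
  set Q := (Γ.neighborFinset d).filter fun n => ¬ w n = w n₀ with hQ
  have hPQ : #P + #Q = k := by
    rw [← hcard]; exact Finset.card_filter_add_card_filter_not _
  have hQw : ∀ n ∈ Q, w n = -w n₀ := fun n hn => by
    rw [hQ, Finset.mem_filter] at hn
    exact (eq_or_eq_neg_of_mem_span_pair (ρ.vec_ne_zero d) hdP (hmemP n₀ hn₀) (hmemP n hn.1)
      (horth n₀ hn₀) (horth n hn.1)
      ((hnorm n hn.1).trans (hnorm n₀ hn₀).symm)).resolve_left hn.2
  have hPw : ∀ n ∈ P, w n = w n₀ := fun n hn => (Finset.mem_filter.1 hn).2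
  have hPQ' : #P = #Q := by
    rw [← Finset.sum_filter_add_sum_filter_not _ (fun n => w n = w n₀),
      Finset.sum_congr rfl hPw, Finset.sum_congr rfl hQw, Finset.sum_const, Finset.sum_const,
      smul_neg, ← sub_eq_add_neg, ← Nat.cast_smul_eq_nsmul ℝ, ← Nat.cast_smul_eq_nsmul ℝ,
      ← sub_smul, smul_eq_zero, or_iff_left hw0, sub_eq_zero] at hsum
    exact_mod_cast hsum
  have hmeet : ∀ F ⊆ Γ.neighborFinset d, 1 < #F → (∀ n ∈ F, ∀ n' ∈ F, w n = w n') →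
      ∃ n ∈ F, n ∈ S := by
    intro F hF hF1 hFw
    by_contra! hno
    obtain ⟨n, hn, n', hn', hne⟩ := Finset.one_lt_card.1 hF1
    have hvec : ρ.vec n = ρ.vec n' := sub_left_injective (hFw n hn n' hn')
    have h1 := (hadj d hd n ((Γ.mem_neighborFinset _ _).1 (hF hn))).resolve_left (hno n hn)
    have h2 := (hadj d hd n' ((Γ.mem_neighborFinset _ _).1 (hF hn'))).resolve_left (hno n' hn')
    rcases h1 with rfl | rfl <;> rcases h2 with rfl | rfl
    · exact hne rfl
    · exact hxy hvec
    · exact hxy hvec.symm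
    · exact hne rfl
  obtain ⟨n, hn, hnS⟩ := hmeet P (Finset.filter_subset _ _) (by omega)
    fun n hn n' hn' => (hPw n hn).trans (hPw n' hn').symm
  obtain ⟨n', hn', hnS'⟩ := hmeet Q (Finset.filter_subset _ _) (by omega)
    fun n hn n' hn' => (hQw n hn).trans (hQw n' hn').symm
  have h1 : ⟪g, w n⟫ + ⟪g, w n'⟫ = 0 := by
    rw [hPw n hn, hQw n' hn', inner_neg_right, add_neg_cancel]
  simp only [hw, inner_sub_right, real_inner_smul_right] at h1
  have h2 := hmin n hnS
  have h3 := hmin n' hnS'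
  nlinarith [hg d hd]

variable [FiniteDimensional ℝ E]

theorem le_two_of_add_eq_zero {k : ℕ} (hreg : Γ.IsRegularOfDegree k) (hk : 0 < k) {x y : X}
    {C D : Finset X} (hsep : Γ.Separates x y C D) (hC : C.Nonempty) (hD : D.Nonempty)
    (hxy : ρ.vec x + ρ.vec y = 0) : k ≤ 2 := by
  classical
  have hy : ρ.vec y = -ρ.vec x := eq_neg_of_add_eq_zero_right hxy
  have hmemT : ∀ {n}, n = x ∨ n = y → ρ.vec n ∈ Submodule.span ℝ {ρ.vec x} := by
    rintro n (rfl | rfl)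
    · exact Submodule.mem_span_singleton_self _
    · rw [hy]; exact Submodule.neg_mem _ (Submodule.mem_span_singleton_self _)
  have hexists : ∀ {C D : Finset X}, Γ.Separates x y C D → C.Nonempty →
      ∃ c ∈ C, ρ.vec c ∉ Submodule.span ℝ {ρ.vec x} := by
    intro C D hsep hC
    by_contra! hall
    obtain ⟨c, hc⟩ := hC
    obtain ⟨n, hn⟩ : (Γ.neighborFinset c).Nonempty := by
      rw [← Finset.card_pos, Γ.card_neighborFinset_eq_degree, hreg c]; exact hk
    rw [Γ.mem_neighborFinset] at hn
    refine ρ.not_mem_span_singleton hn (hall c hc) ?_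
    rcases hsep.adj_left c hc n hn with h | h
    · exact hall n h
    · exact hmemT h
  obtain ⟨c₀, hc₀, hcx⟩ := hexists hsep hC
  obtain ⟨d₀, hd₀, hdx⟩ := hexists hsep.symm hD
  obtain ⟨g, hgx, hgc⟩ := Submodule.exists_inner_pos_of_notMem hcx
  obtain ⟨g', hgx', hgd⟩ := Submodule.exists_inner_pos_of_notMem hdx
  have hprop : ∀ h : E, ⟪h, ρ.vec x⟫ = 0 → ∀ v ∈ C, 0 < ⟪h, ρ.vec v⟫ → ∀ n, Γ.Adj v n →
      (n ∈ C ∧ 0 < ⟪h, ρ.vec n⟫) ∨ ((n = x ∨ n = y) ∧ ⟪h, ρ.vec n⟫ = 0) := by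
    intro h hh v hv hpos n hn
    refine hsep.pos_of_adj ρ.rayleigh (ρ.sum_inner h) (ρ.sum_inner g') hh.le ?_
      (hgx' _ (hmemT (.inl rfl))).le (hgx' _ (hmemT (.inr rfl))).le ⟨d₀, hd₀, hgd⟩ hv hpos hn
    rw [hy, inner_neg_right, hh, neg_zero]
  have hgx0 := hgx _ (hmemT (.inl rfl))
  refine ρ.le_two_of_locally_planar hreg (x := x) (y := y) (g := g)
    (S := C.filter fun v => 0 < ⟪g, ρ.vec v⟫) ?_ ⟨c₀, by simp [hc₀, hgc]⟩ ?_ ?_ ?_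
  · intro h
    rw [← h, ← two_smul ℝ, smul_eq_zero, or_iff_right two_ne_zero] at hxy
    exact ρ.vec_ne_zero x hxy
  · intro d hd n hn
    rw [Finset.mem_filter] at hd ⊢
    exact (hprop g hgx0 d hd.1 hd.2 n hn).imp id And.left
  · intro d hd
    exact (Finset.mem_filter.1 hd).2
  · intro d hd
    rw [Finset.mem_filter] at hd
    have hxP : ρ.vec x ∈ Submodule.span ℝ {ρ.vec x, ρ.vec d} :=
      Submodule.subset_span (by simp)
    have hdP : ρ.vec d ∈ Submodule.span ℝ {ρ.vec x, ρ.vec d} :=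
      Submodule.subset_span (by simp)
    refine ⟨ρ.vec x, ρ.vec d, hdP, fun n hn => ?_⟩
    rcases hsep.adj_left d hd.1 n hn with hnC | rfl | rfl
    · by_contra hnP
      obtain ⟨h, hh, hhn⟩ := Submodule.exists_inner_pos_of_notMem hnP
      have hhd := hh _ hdP
      rcases hprop h (hh _ hxP) n hnC hhn d hn.symm with h1 | ⟨rfl | rfl, -⟩
      · linarith [h1.2]
      · exact hsep.left_notMem_left hd.1
      · exact hsep.right_notMem_left hd.1
    · exact hxP
    · rw [hy]; exact Submodule.neg_mem _ hxP

/-- A vertex represented outside the convex cone of `x` and `y` is separated from both by a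
hyperplane. -/
theorem exists_inner_neg_of_notMem {x y d : X} (hxy : ρ.vec x + ρ.vec y ≠ 0)
    (hd : ρ.vec d ∉ Submodule.span ℝ {ρ.vec x, ρ.vec y} ∨
      ⟪ρ.vec x + ρ.vec y, ρ.vec d⟫ ≤ 0) :
    ∃ h : E, ⟪h, ρ.vec x⟫ < 0 ∧ ⟪h, ρ.vec y⟫ < 0 ∧ 0 < ⟪h, ρ.vec d⟫ := by
  have hpos := real_inner_self_pos.2 hxy
  set s := ρ.vec x + ρ.vec y with hs
  have hsx : 0 < ⟪s, ρ.vec x⟫ := by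
    simp only [hs, inner_add_left, inner_add_right, ρ.inner_self] at hpos ⊢
    linarith [real_inner_comm (ρ.vec x) (ρ.vec y)]
  have hsy : 0 < ⟪s, ρ.vec y⟫ := by
    simp only [hs, inner_add_left, inner_add_right, ρ.inner_self] at hpos ⊢
    linarith [real_inner_comm (ρ.vec x) (ρ.vec y)]
  rcases hd with hd | hd
  · obtain ⟨w, hw, hwd⟩ := Submodule.exists_inner_pos_of_notMem hd
    obtain ⟨ε, hε, hεd⟩ := exists_pos_mul_lt hwd ⟪s, ρ.vec d⟫
    have hwx := hw (ρ.vec x) (Submodule.subset_span (by simp))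
    have hwy := hw (ρ.vec y) (Submodule.subset_span (by simp))
    refine ⟨w - ε • s, ?_, ?_, ?_⟩ <;> rw [inner_sub_left, real_inner_smul_left]
    · nlinarith
    · nlinarith
    · linarith
  · obtain ⟨ε, hε, hεx⟩ := exists_pos_mul_lt hsx ⟪ρ.vec d, ρ.vec x⟫
    obtain ⟨ε', hε', hεy⟩ := exists_pos_mul_lt hsy ⟪ρ.vec d, ρ.vec y⟫
    have hq := ρ.normSq_pos
    have hmin := lt_min hε hε'
    refine ⟨min ε ε' • ρ.vec d - s, ?_, ?_, ?_⟩ <;> rw [inner_sub_left, real_inner_smul_left]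
    · rcases le_total 0 ⟪ρ.vec d, ρ.vec x⟫ with h | h
      · nlinarith [min_le_left ε ε']
      · nlinarith
    · rcases le_total 0 ⟪ρ.vec d, ρ.vec y⟫ with h | h
      · nlinarith [min_le_right ε ε']
      · nlinarith
    · rw [ρ.inner_self]
      nlinarith

theorem le_two_of_add_ne_zero {k : ℕ} (hreg : Γ.IsRegularOfDegree k) (hk : 0 < k)
    (hconn : Γ.Connected) {x y : X}
    {C D : Finset X} (hsep : Γ.Separates x y C D) (hC : C.Nonempty) (hD : D.Nonempty)
    (hxy : ρ.vec x + ρ.vec y ≠ 0) : k ≤ 2 := by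
  classical
  have hside : ∀ {C D : Finset X}, Γ.Separates x y C D → C.Nonempty →
      (∀ c ∈ C, ¬ ∃ h : E, ⟪h, ρ.vec x⟫ < 0 ∧ ⟪h, ρ.vec y⟫ < 0 ∧ 0 < ⟪h, ρ.vec c⟫) → k ≤ 2 := by
    intro C D hsep hC hnone
    have hpl : ∀ c ∈ C, ρ.vec c ∈ Submodule.span ℝ {ρ.vec x, ρ.vec y} ∧
        0 < ⟪ρ.vec x + ρ.vec y, ρ.vec c⟫ := by
      intro c hc
      by_contra hcon
      rw [not_and_or, not_lt] at hcon
      exact hnone c hc (ρ.exists_inner_neg_of_notMem hxy hcon)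
    have hnb : ∀ c ∈ C, ∀ n, Γ.Adj c n → ρ.vec n ∈ Submodule.span ℝ {ρ.vec x, ρ.vec y} := by
      intro c hc n hn
      rcases hsep.adj_left c hc n hn with h | rfl | rfl
      · exact (hpl n h).1
      · exact Submodule.subset_span (by simp)
      · exact Submodule.subset_span (by simp)
    by_cases heq : ρ.vec x = ρ.vec y
    · obtain ⟨c, hc⟩ := hC
      obtain ⟨n, hn⟩ : (Γ.neighborFinset c).Nonempty := by
        rw [← Finset.card_pos, Γ.card_neighborFinset_eq_degree, hreg c]; exact hk
      rw [Γ.mem_neighborFinset] at hn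
      have h1 := (hpl c hc).1
      have h2 := hnb c hc n hn
      rw [heq, Set.pair_eq_singleton] at h1 h2
      exact absurd h2 (ρ.not_mem_span_singleton hn h1)
    · exact ρ.le_two_of_locally_planar hreg heq hC hsep.adj_left (fun c hc => (hpl c hc).2)
        fun c hc => ⟨_, _, (hpl c hc).1, hnb c hc⟩
  by_cases h1 : ∀ c ∈ C, ¬ ∃ h : E, ⟪h, ρ.vec x⟫ < 0 ∧ ⟪h, ρ.vec y⟫ < 0 ∧ 0 < ⟪h, ρ.vec c⟫
  · exact hside hsep hC h1
  by_cases h2 : ∀ d ∈ D, ¬ ∃ h : E, ⟪h, ρ.vec x⟫ < 0 ∧ ⟪h, ρ.vec y⟫ < 0 ∧ 0 < ⟪h, ρ.vec d⟫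
  · exact hside hsep.symm hD h2
  push Not at h1 h2
  obtain ⟨c, hc, h, hx, hy, hhc⟩ := h1
  obtain ⟨d, hd, h', hx', hy', hhd⟩ := h2
  have hall := hconn.mem_of_adj_closed (S := {v | v ∈ C ∧ 0 < ⟪h, ρ.vec v⟫}) ⟨c, hc, hhc⟩
    (fun v hv n hn => by
      rcases hsep.pos_of_adj ρ.rayleigh (ρ.sum_inner h) (ρ.sum_inner h') hx.le hy.le hx'.le hy'.le
        ⟨d, hd, hhd⟩ hv.1 hv.2 hn with h | ⟨rfl | rfl, h0⟩
      · exact h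
      · exact absurd h0 hx.ne
      · exact absurd h0 hy.ne) x
  exact absurd hall.1 hsep.left_notMem_left

end SimpleGraph.TopRepresentation

theorem SimpleGraph.exists_topRepresentation {X : Type*} [Fintype X] [DecidableEq X]
    {Γ : SimpleGraph X} [DecidableRel Γ.Adj] (hconn : Γ.Connected) {k : ℕ}
    (hreg : Γ.IsRegularOfDegree k) (hk : 0 < k) {a b : X} (hab : a ≠ b) (hnadj : ¬ Γ.Adj a b)
    (S : Subalgebra ℝ (Matrix X X ℝ)) (hAS : Γ.adjMatrix ℝ - Matrix.of (fun _ _ => 1) ∈ S)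
    (hsymm : ∀ N ∈ S, ∀ v w, N v w = N w v) (hdiag : ∀ N ∈ S, ∀ v w, N v v = N w w)
    (hedge : ∀ N ∈ S, ∀ v w v' w', Γ.Adj v w → Γ.Adj v' w' → N v w = N v' w') :
    Nonempty (Γ.TopRepresentation (EuclideanSpace ℝ X)) := by
  have : Nonempty X := ⟨a⟩
  set B : Matrix X X ℝ := Γ.adjMatrix ℝ - Matrix.of (fun _ _ => 1) with hBdef
  have hmulVec : ∀ (f : X → ℝ) v,
      (B.mulVec f) v = ∑ n ∈ Γ.neighborFinset v, f n - ∑ n, f n := fun f v => by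
    rw [hBdef, Matrix.sub_mulVec, Pi.sub_apply, SimpleGraph.adjMatrix_mulVec_apply]
    simp [Matrix.mulVec, dotProduct]
  have hB : B.IsHermitian := by
    ext v w
    simpa using hsymm B hAS w v
  obtain ⟨r, hpsd, q, hM0, hBM⟩ := hB.exists_top_eigenvalue
  have hMS : Polynomial.aeval B q ∈ S :=
    Algebra.adjoin_le (by simpa using hAS) (Polynomial.aeval_mem_adjoin_singleton ℝ B)
  set M := Polynomial.aeval B q
  have hquad : ∀ f : X → ℝ, ∀ v, ((r • (1 : Matrix X X ℝ) - B).mulVec f) v =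
      r * f v - (∑ n ∈ Γ.neighborFinset v, f n - ∑ n, f n) := fun f v => by
    rw [Matrix.sub_mulVec, Pi.sub_apply, hmulVec, Matrix.smul_mulVec, Matrix.one_mulVec]
    simp
  have hr : 0 ≤ r := by
    have h := hpsd.dotProduct_mulVec_nonneg (Pi.single a 1 - Pi.single b 1)
    rw [star_trivial, sub_dotProduct, single_dotProduct, single_dotProduct, hquad, hquad] at h
    have hnadj' : ¬ Γ.Adj b a := fun h => hnadj h.symm
    simp [Finset.sum_sub_distrib, hab, hab.symm, hnadj, hnadj', Pi.single_apply] at h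
    linarith
  have hcol : ∀ v w, ∑ n ∈ Γ.neighborFinset v, M n w - ∑ n, M n w = r * M v w := fun v w => by
    rw [← hmulVec (fun n => M n w) v]
    have := congrFun (congrFun hBM v) w
    rwa [Matrix.mul_apply, Matrix.smul_apply, smul_eq_mul] at this
  have hkX : k < Fintype.card X := by
    rw [← hreg a]; exact Γ.degree_lt_card_verts a
  have hzero : ∀ w, ∑ n, M n w = 0 := by
    intro w
    have h1 : ∑ v, ∑ n ∈ Γ.neighborFinset v, M n w = k * ∑ n, M n w := by
      simp only [SimpleGraph.neighborFinset_eq_filter, Finset.sum_filter]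
      rw [Finset.sum_comm, Finset.mul_sum]
      refine Finset.sum_congr rfl fun n _ => ?_
      rw [← Finset.sum_filter, Finset.sum_const, nsmul_eq_mul, ← hreg n,
        ← Γ.card_neighborFinset_eq_degree, SimpleGraph.neighborFinset_eq_filter]
      simp only [Γ.adj_comm]
    have h2 := Finset.sum_congr rfl fun v (_ : v ∈ univ) => hcol v w
    rw [Finset.sum_sub_distrib, h1, ← Finset.mul_sum, Finset.sum_const, Finset.card_univ,
      nsmul_eq_mul] at h2
    have h3 : ((Fintype.card X : ℝ) - k + r) * ∑ n, M n w = 0 := by linarith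
    have h4 : (k : ℝ) < Fintype.card X := by exact_mod_cast hkX
    exact (mul_eq_zero.1 h3).resolve_left (by linarith)
  set u : X → EuclideanSpace ℝ X := fun v => WithLp.toLp 2 (fun w => M w v) with hu
  have hinner : ∀ v w, ⟪u v, u w⟫ = (M * M) v w := fun v w => by
    simp only [hu, PiLp.inner_apply, Matrix.mul_apply]
    refine Finset.sum_congr rfl fun z _ => ?_
    rw [hsymm M hMS v z]
    simp [mul_comm]
  have hsum : ∀ v, ∑ n ∈ Γ.neighborFinset v, u n = r • u v := fun v => by
    ext w
    have h := hcol v w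
    rw [hzero, sub_zero] at h
    simp only [hu, WithLp.ofLp_sum, Finset.sum_apply, PiLp.smul_apply, smul_eq_mul]
    rw [hsymm M hMS w v, ← h]
    exact Finset.sum_congr rfl fun n _ => hsymm M hMS w n
  have hMMS := S.mul_mem hMS hMS
  obtain ⟨a', ha'⟩ : (Γ.neighborFinset a).Nonempty := by
    rw [← Finset.card_pos, Γ.card_neighborFinset_eq_degree, hreg a]; exact hk
  rw [Γ.mem_neighborFinset] at ha'
  have hself : ∀ v, ⟪u v, u v⟫ = (M * M) a a := fun v =>
    (hinner v v).trans (hdiag _ hMMS v a)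
  have hadj : ∀ v w, Γ.Adj v w → ⟪u v, u w⟫ = (M * M) a a' := fun v w h =>
    (hinner v w).trans (hedge _ hMMS v w a a' h ha')
  have hlt : (M * M) a a' < (M * M) a a := by
    have hsub : ∀ v w, Γ.Adj v w →
        ⟪u v - u w, u v - u w⟫ = 2 * ((M * M) a a - (M * M) a a') := fun v w h => by
      rw [real_inner_sub_sub_self, hself, hself, hadj v w h]; ring
    have hle := real_inner_self_nonneg (x := u a - u a')
    rw [hsub a a' ha'] at hle
    refine lt_of_le_of_ne (by linarith) fun heq => hM0 ?_
    have hconst : ∀ v, u v = u a := hconn.mem_of_adj_closed (S := {v | u v = u a}) ⟨a, rfl⟩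
      fun v hv w hvw => by
        have h := hsub v w hvw
        rw [heq, sub_self, mul_zero, inner_self_eq_zero, sub_eq_zero] at h
        exact h.symm.trans hv
    have hentry : ∀ z v, M z v = M z a := fun z v => congrArg (fun e => e.ofLp z) (hconst v)
    ext z v
    have h := hzero z
    rw [Finset.sum_congr rfl fun n _ => (hsymm M hMS n z).trans (hentry z n), Finset.sum_const,
      Finset.card_univ, nsmul_eq_mul] at h
    rw [hentry, Matrix.zero_apply]
    exact (mul_eq_zero.1 h).resolve_left (by exact_mod_cast Fintype.card_ne_zero)
  have hedge_eq : (k : ℝ) * (M * M) a a' = r * (M * M) a a := by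
    have h := congrArg (fun z => ⟪u a, z⟫) (hsum a)
    simp only [inner_sum, real_inner_smul_right, hself] at h
    rw [Finset.sum_congr rfl fun n hn => hadj a n ((Γ.mem_neighborFinset _ _).1 hn),
      Finset.sum_const, Γ.card_neighborFinset_eq_degree, hreg a, nsmul_eq_mul] at h
    exact h
  have hself_nonneg : 0 ≤ (M * M) a a := by
    rw [← hself a]; exact real_inner_self_nonneg
  exact ⟨{
    vec := u
    normSq := (M * M) a a
    edgeInner := (M * M) a a'
    eigenvalue := r
    inner_self := hself
    inner_adj := hadj
    edgeInner_nonneg := by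
      have hk' : (0 : ℝ) < k := by exact_mod_cast hk
      exact nonneg_of_mul_nonneg_right (hedge_eq ▸ mul_nonneg hr hself_nonneg) hk'
    edgeInner_lt := hlt
    sum_neighbor := hsum
    rayleigh := by
      intro f hf hle v
      have hform : star f ⬝ᵥ (r • (1 : Matrix X X ℝ) - B).mulVec f = 0 := by
        refine le_antisymm ?_ (hpsd.dotProduct_mulVec_nonneg f)
        rw [star_trivial]
        refine Finset.sum_nonpos fun v _ => ?_
        rw [hquad, hf, sub_zero]
        linarith [hle v]
      have h := congrFun ((hpsd.dotProduct_mulVec_zero_iff f).1 hform) v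
      rw [hquad, hf, sub_zero, Pi.zero_apply] at h
      linarith }⟩

/-- A disconnecting pair of vertices yields a separation with nonempty sides. -/
theorem SimpleGraph.exists_separates {X : Type*} [Fintype X] [DecidableEq X] {Γ : SimpleGraph X}
    {x y : X} (hdisc : ¬ (Γ.induce (({x, y} : Set X)ᶜ)).Preconnected) :
    ∃ C D : Finset X, Γ.Separates x y C D ∧ C.Nonempty ∧ D.Nonempty := by
  classical
  simp only [SimpleGraph.Preconnected, not_forall] at hdisc
  obtain ⟨a, b, hab⟩ := hdisc
  let P : X → Prop := fun v => ∃ hv : v ∈ (({x, y} : Set X)ᶜ),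
    (Γ.induce (({x, y} : Set X)ᶜ)).Reachable a ⟨v, hv⟩
  have hadj : ∀ v w, P v → Γ.Adj v w → w ∈ (({x, y} : Set X)ᶜ) → P w := by
    rintro v w ⟨hv, hav⟩ hvw hw
    refine ⟨hw, hav.trans (SimpleGraph.Adj.reachable ?_)⟩
    simpa using hvw
  have hT : ∀ w, w ∈ (({x, y} : Set X)ᶜ) ∨ w = x ∨ w = y := fun w => by
    simp only [Set.mem_compl_iff, Set.mem_insert_iff, Set.mem_singleton_iff]
    tauto
  have hPx : ¬ P x := fun ⟨h, _⟩ => h (by simp)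
  have hPy : ¬ P y := fun ⟨h, _⟩ => h (by simp)
  refine ⟨univ.filter P, univ.filter fun v => v ∈ (({x, y} : Set X)ᶜ) ∧ ¬ P v,
    ⟨?_, ?_, ?_, ?_, ?_, ?_, ?_⟩, ⟨a, ?_⟩, ⟨b, ?_⟩⟩
  · rw [Finset.disjoint_left]
    intro v hv hv'
    exact (Finset.mem_filter.1 hv').2.2 (Finset.mem_filter.1 hv).2
  · simpa using hPx
  · simpa using hPy
  · simp
  · simp
  · intro v hv w hvw
    refine (hT w).imp_left fun hw => ?_
    exact Finset.mem_filter.2 ⟨mem_univ _, hadj v w (Finset.mem_filter.1 hv).2 hvw hw⟩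
  · intro v hv w hvw
    obtain ⟨hv, hPv⟩ := (Finset.mem_filter.1 hv).2
    refine (hT w).imp_left fun hw => ?_
    exact Finset.mem_filter.2 ⟨mem_univ _, hw, fun hPw => hPv (hadj w v hPw hvw.symm hv)⟩
  · exact Finset.mem_filter.2 ⟨mem_univ _, a.2, SimpleGraph.Reachable.refl _⟩
  · exact Finset.mem_filter.2 ⟨mem_univ _, b.2, fun ⟨_, h⟩ => hab h⟩

theorem SimpleGraph.Connected.two_le_of_isRegularOfDegree {V : Type*} [Fintype V] [DecidableEq V]
    {G : SimpleGraph V} [DecidableRel G.Adj] (hG : G.Connected) {k : ℕ}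
    (hreg : G.IsRegularOfDegree k) (hV : 2 < Fintype.card V) : 2 ≤ k := by
  by_contra! hk
  obtain ⟨a⟩ := hG.nonempty
  have hall : ∀ w, w ∈ insert a (G.neighborFinset a) := by
    refine hG.mem_of_adj_closed (S := ↑(insert a (G.neighborFinset a)))
      ⟨a, by simp⟩ fun v hv w hvw => ?_
    simp only [Finset.coe_insert, SimpleGraph.coe_neighborFinset, Set.mem_insert_iff,
      SimpleGraph.mem_neighborSet] at hv ⊢
    rcases hv with rfl | hv
    · exact .inr hvw
    · left
      have h1 : #(G.neighborFinset v) ≤ 1 := by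
        rw [G.card_neighborFinset_eq_degree, hreg v]; omega
      exact Finset.card_le_one.1 h1 w (by simpa using hvw) a (by simpa using hv.symm)
  have h1 := Finset.card_le_card (fun w _ => hall w : univ ⊆ insert a (G.neighborFinset a))
  have h2 := Finset.card_insert_le a (G.neighborFinset a)
  rw [Finset.card_univ] at h1
  rw [G.card_neighborFinset_eq_degree, hreg a] at h2
  omega

/-- A connected basis relation of a symmetric association scheme admitting a
disconnecting set of size two is isomorphic to a polygon (cycle graph). -/
theorem stmt_17 (X : Type) [Fintype X] (d : ℕ) (hd : 1 ≤ d)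
    (R : Fin (d + 1) → X → X → Prop)
    (hR0 : ∀ x y, R 0 x y ↔ x = y)
    (hpart : ∀ x y : X, ∃! i, R i x y)
    (hsym : ∀ i x y, R i x y → R i y x)
    (p : Fin (d + 1) → Fin (d + 1) → Fin (d + 1) → ℕ)
    (hp : ∀ i j k x y, R k x y → {z : X | R i x z ∧ R j z y}.ncard = p i j k)
    (Γ : SimpleGraph X) (hΓ : ∀ x y, Γ.Adj x y ↔ x ≠ y ∧ R 1 x y)
    (hconn : Γ.Connected)
    (T : Finset X) (hT : T.card = 2)
    (hdisc : ¬ (Γ.induce ((↑T : Set X)ᶜ)).Preconnected) :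
    ∃ n : ℕ, Nonempty (Γ ≃g SimpleGraph.cycleGraph n) := by
  classical
  obtain ⟨x, y, hxy, rfl⟩ := Finset.card_eq_two.1 hT
  rw [Finset.coe_pair] at hdisc
  obtain ⟨C, D, hsep, hC, hD⟩ := SimpleGraph.exists_separates hdisc
  choose c hc hcuniq using fun v w => (hpart v w)
  have hcR : ∀ i v w, R i v w ↔ c v w = i := fun i v w =>
    ⟨fun h => (hcuniq v w i h).symm, fun h => h ▸ hc v w⟩
  have h10 : (1 : Fin (d + 1)) ≠ 0 := by
    obtain ⟨e, rfl⟩ : ∃ e, d = e + 1 := ⟨d - 1, by omega⟩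
    exact one_ne_zero
  have hc0 : ∀ v w, c v w = 0 ↔ v = w := fun v w => by rw [← hcR, hR0]
  have hc1 : ∀ v w, Γ.Adj v w ↔ c v w = 1 := fun v w => by
    rw [hΓ, hcR, and_iff_right_iff_imp]
    rintro h rfl
    exact h10 (h.symm.trans ((hc0 v v).2 rfl))
  have hcsymm : ∀ v w, c v w = c w v := fun v w =>
    ((hcR _ w v).1 (hsym _ v w (hc v w))).symm
  have hcp : ∀ i j v w, #{z | c v z = i ∧ c z w = j} = p i j (c v w) := fun i j v w => by
    rw [← hp i j _ v w (hc v w), ← Set.ncard_coe_finset]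
    simp [hcR]
  have hreg : Γ.IsRegularOfDegree (p 1 1 0) := fun v => by
    rw [← (hc0 v v).2 rfl, ← hcp, ← Γ.card_neighborFinset_eq_degree]
    congr 1
    ext z
    simp [hc1, hcsymm z v]
  obtain ⟨a, ha⟩ := hC
  obtain ⟨b, hb⟩ := hD
  have hk2 : 2 ≤ p 1 1 0 := by
    refine hconn.two_le_of_isRegularOfDegree hreg (Fintype.two_lt_card_iff.2 ⟨x, y, a, hxy, ?_, ?_⟩)
    · rintro rfl; exact hsep.left_notMem_left ha
    · rintro rfl; exact hsep.right_notMem_left ha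
  have hbC : b ∉ C := fun h => Finset.disjoint_left.1 hsep.disjoint h hb
  obtain ⟨ρ⟩ := Γ.exists_topRepresentation hconn hreg (by omega) (a := a) (b := b)
    (by rintro rfl; exact hbC ha)
    (fun h => by
      rcases hsep.adj_left a ha b h with h | rfl | rfl
      · exact hbC h
      · exact hsep.left_notMem_right hb
      · exact hsep.right_notMem_right hb)
    (colourSubalgebra c 0 hc0 p hcp)
    ⟨fun i => (if i = 1 then 1 else 0) - 1, fun v w => by simp [SimpleGraph.adjMatrix_apply, hc1]⟩
    (by rintro N ⟨m, hm⟩ v w; rw [hm, hm, hcsymm])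
    (by rintro N ⟨m, hm⟩ v w; rw [hm, hm, (hc0 v v).2 rfl, (hc0 w w).2 rfl])
    (by rintro N ⟨m, hm⟩ v w v' w' h h'; rw [hm, hm, (hc1 v w).1 h, (hc1 v' w').1 h'])
  have hk : p 1 1 0 = 2 := by
    refine le_antisymm ?_ hk2
    by_cases h : ρ.vec x + ρ.vec y = 0
    · exact ρ.le_two_of_add_eq_zero hreg (by omega) hsep ⟨a, ha⟩ ⟨b, hb⟩ h
    · exact ρ.le_two_of_add_ne_zero hreg (by omega) hconn hsep ⟨a, ha⟩ ⟨b, hb⟩ h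
  rw [hk] at hreg
  exact hconn.nonempty_iso_cycleGraph hreg
end

section
/- Let X be a finite set and let R_0, …, R_d be relations on X forming a symmetric association scheme (R_0 the identity relation, the R_i partitioning X × X, each R_i symmetric, and with well-defined intersection numbers p^k_{ij}). Let Γ be the simple graph on X whose edges are the pairs in R_1, assume Γ is connected, and assume Γ contains no induced subgraph isomorphic to K_{2,1,1} (the complete multipartite graph with parts of sizes 2, 1, 1, i.e., K_4 minus an edge). If T ⊆ X is a disconnecting set for Γ (the induced subgraph of Γ on X ∖ T is disconnected), then |T| > p^1_{11}. -/
open Matrix Finset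

namespace SimpleGraph

variable {V : Type*} [Fintype V] {G : SimpleGraph V} [DecidableRel G.Adj]

lemma sum_adjMatrix_mulVec {k : ℕ} (hreg : G.IsRegularOfDegree k) (h : V → ℝ) :
    ∑ x, (G.adjMatrix ℝ *ᵥ h) x = k * ∑ x, h x := by
  have h1 : (fun _ : V => (1 : ℝ)) ᵥ* G.adjMatrix ℝ = fun _ => (k : ℝ) := by
    ext x
    rw [← mulVec_transpose, transpose_adjMatrix, adjMatrix_mulVec_apply]
    simp [hreg.degree_eq x]
  have h2 := dotProduct_mulVec (fun _ : V => (1 : ℝ)) (G.adjMatrix ℝ) h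
  rw [h1] at h2
  simpa [dotProduct, Finset.mul_sum] using h2

/-- A vector of sum zero that attains the maximal Rayleigh quotient is an eigenvector. -/
lemma adjMatrix_mulVec_eq_of_isMax {k : ℕ} (hreg : G.IsRegularOfDegree k) {θ : ℝ}
    (hmax : ∀ h : V → ℝ, ∑ x, h x = 0 → h ⬝ᵥ (G.adjMatrix ℝ *ᵥ h) ≤ θ * (h ⬝ᵥ h))
    {h : V → ℝ} (hsum : ∑ x, h x = 0) (hle : θ * (h ⬝ᵥ h) ≤ h ⬝ᵥ (G.adjMatrix ℝ *ᵥ h)) :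
    G.adjMatrix ℝ *ᵥ h = θ • h := by
  set A := G.adjMatrix ℝ with hA
  set g := A *ᵥ h - θ • h with hg
  have hgsum : ∑ x, g x = 0 := by
    simp only [hg, Pi.sub_apply, Pi.smul_apply, smul_eq_mul, Finset.sum_sub_distrib,
      ← Finset.mul_sum, hsum, hA, sum_adjMatrix_mulVec hreg, mul_zero, sub_zero]
  have hsymm : h ⬝ᵥ (A *ᵥ g) = g ⬝ᵥ (A *ᵥ h) := by
    rw [dotProduct_mulVec, ← mulVec_transpose, hA, transpose_adjMatrix, dotProduct_comm]
  have hquad : ∀ t : ℝ, 0 ≤ (θ * (g ⬝ᵥ g) - g ⬝ᵥ (A *ᵥ g)) * (t * t) + (-2 * (g ⬝ᵥ g)) * t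
      + 0 := by
    intro t
    have h1 := hmax (h + t • g) (by
      simp [Finset.sum_add_distrib, ← Finset.mul_sum, hsum, hgsum])
    have hgg : g ⬝ᵥ g = g ⬝ᵥ (A *ᵥ h) - θ * (g ⬝ᵥ h) := by
      conv_lhs => rw [hg, dotProduct_sub, dotProduct_smul, smul_eq_mul]
    simp only [mulVec_add, mulVec_smul, add_dotProduct, dotProduct_add, smul_dotProduct,
      dotProduct_smul, smul_eq_mul, hsymm] at h1
    rw [dotProduct_comm h g] at h1
    have htgg := congrArg (t * ·) hgg
    linarith
  have hdiscr := discrim_le_zero hquad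
  have hzero : g ⬝ᵥ g = 0 := by
    rw [discrim] at hdiscr
    nlinarith [sq_nonneg (g ⬝ᵥ g)]
  exact sub_eq_zero.1 (dotProduct_self_eq_zero.1 hzero)

variable [DecidableEq V]

variable (G) in
/-- Quadratic forms of the adjacency matrix attain their maximum on unit vectors of sum zero. -/
lemma exists_isMax_adjMatrix_quadratic {a b : V} (hab : a ≠ b) :
    ∃ v : V → ℝ, v ≠ 0 ∧ ∑ x, v x = 0 ∧ ∃ θ : ℝ, v ⬝ᵥ (G.adjMatrix ℝ *ᵥ v) = θ * (v ⬝ᵥ v) ∧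
      ∀ h : V → ℝ, ∑ x, h x = 0 → h ⬝ᵥ (G.adjMatrix ℝ *ᵥ h) ≤ θ * (h ⬝ᵥ h) := by
  set S : Set (V → ℝ) := {v | v ⬝ᵥ v = 1 ∧ ∑ x, v x = 0}
  have hclosed : IsClosed S := by
    refine IsClosed.inter ?_ ?_
    · exact isClosed_eq (by simp only [dotProduct]; fun_prop) continuous_const
    · exact isClosed_eq (by fun_prop) continuous_const
  have hcompact : IsCompact S := by
    have hbox := isCompact_univ_pi fun _ : V => isCompact_Icc (a := (-1 : ℝ)) (b := 1)
    refine hbox.of_isClosed_subset hclosed fun v hv x _ => ?_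
    have h1 : v x * v x ≤ v ⬝ᵥ v :=
      Finset.single_le_sum (f := fun x => v x * v x) (fun i _ => mul_self_nonneg _) (mem_univ x)
    rw [hv.1] at h1
    exact abs_le.1 (abs_le_one_iff_mul_self_le_one.2 h1)
  have hscale : ∀ h : V → ℝ, h ≠ 0 → ∑ x, h x = 0 → (√(h ⬝ᵥ h))⁻¹ • h ∈ S := by
    intro h hne hsum
    have hpos : 0 < h ⬝ᵥ h :=
      lt_of_le_of_ne (Finset.sum_nonneg fun i _ => mul_self_nonneg _)
        (fun h0 => hne (dotProduct_self_eq_zero.1 h0.symm))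
    refine ⟨?_, ?_⟩
    · rw [smul_dotProduct, dotProduct_smul, smul_smul, ← mul_inv, Real.mul_self_sqrt hpos.le,
        smul_eq_mul, inv_mul_cancel₀ hpos.ne']
    · simp [← Finset.mul_sum, hsum]
  have hne : S.Nonempty := by
    refine ⟨_, hscale (Pi.single a 1 - Pi.single b 1) ?_ ?_⟩
    · intro h
      have := congrFun h a
      simp [hab] at this
    · simp
  obtain ⟨v, hv, hmax⟩ := hcompact.exists_isMaxOn hne
    (f := fun v => v ⬝ᵥ (G.adjMatrix ℝ *ᵥ v))
    (by simp only [dotProduct, mulVec]; fun_prop)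
  refine ⟨v, ?_, hv.2, v ⬝ᵥ (G.adjMatrix ℝ *ᵥ v), by rw [hv.1, mul_one], fun h hsum => ?_⟩
  · rintro rfl
    simpa using hv.1
  · by_cases h0 : h = 0
    · simp [h0]
    have hpos : 0 < h ⬝ᵥ h :=
      lt_of_le_of_ne (Finset.sum_nonneg fun i _ => mul_self_nonneg _)
        (fun h1 => h0 (dotProduct_self_eq_zero.1 h1.symm))
    have h2 := hmax (hscale h h0 hsum)
    simp only [Set.mem_ofPred_eq] at h2
    rw [mulVec_smul, smul_dotProduct, dotProduct_smul, smul_smul, ← mul_inv,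
      Real.mul_self_sqrt hpos.le, smul_eq_mul, inv_mul_le_iff₀ hpos] at h2
    linarith

/-- The second largest eigenvalue of a connected regular graph that is not complete. -/
lemma Connected.exists_second_eigenvalue {k : ℕ} (hconn : G.Connected)
    (hreg : G.IsRegularOfDegree k) {a b : V} (hab : a ≠ b) (hadj : ¬ G.Adj a b) :
    ∃ θ : ℝ, 0 ≤ θ ∧ θ < k ∧ (∃ v : V → ℝ, v ≠ 0 ∧ G.adjMatrix ℝ *ᵥ v = θ • v) ∧
      ∀ h : V → ℝ, ∑ x, h x = 0 → θ * (h ⬝ᵥ h) ≤ h ⬝ᵥ (G.adjMatrix ℝ *ᵥ h) →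
        G.adjMatrix ℝ *ᵥ h = θ • h := by
  obtain ⟨v, hv, hsum, θ, hθ, hmax⟩ := G.exists_isMax_adjMatrix_quadratic hab
  have heig := adjMatrix_mulVec_eq_of_isMax hreg hmax hsum hθ.ge
  refine ⟨θ, ?_, ?_, ⟨v, hv, heig⟩, fun h => adjMatrix_mulVec_eq_of_isMax hreg hmax⟩
  · have h1 := hmax (Pi.single a 1 - Pi.single b 1) (by simp)
    have hba : ¬ G.Adj b a := fun h => hadj h.symm
    simp [sub_dotProduct, mulVec_sub, hadj, hba, hab, hab.symm] at h1
    linarith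
  · have hlap : G.lapMatrix ℝ *ᵥ v = ((k : ℝ) - θ) • v := by
      ext x
      have := congrFun heig x
      rw [lapMatrix, sub_mulVec, Pi.sub_apply, this, degMatrix, mulVec_diagonal, hreg.degree_eq x]
      simp [sub_mul]
    have hpos : 0 < v ⬝ᵥ v :=
      lt_of_le_of_ne (Finset.sum_nonneg fun i _ => mul_self_nonneg _)
        (fun h1 => hv (dotProduct_self_eq_zero.1 h1.symm))
    have hle : 0 ≤ v ⬝ᵥ (G.lapMatrix ℝ *ᵥ v) := by
      simpa using (G.posSemidef_lapMatrix ℝ).dotProduct_mulVec_nonneg v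
    rw [hlap, dotProduct_smul, smul_eq_mul] at hle
    refine lt_of_le_of_ne (by nlinarith) ?_
    rintro rfl
    rw [sub_self, zero_smul, lapMatrix_mulVec_eq_zero_iff_forall_reachable] at hlap
    refine hv (funext fun x => ?_)
    have h1 : ∑ y, v y = Fintype.card V * v x := by
      rw [Finset.sum_congr rfl fun y _ => hlap y x (hconn.preconnected y x)]
      simp
    have : Nonempty V := ⟨x⟩
    rw [hsum, eq_comm, mul_eq_zero] at h1
    simpa using h1

/-- The absolute value of an eigenvector vanishing on `T`, cut off outside a union of components
of the complement of `T`, is subharmonic. -/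
lemma smul_le_adjMatrix_mulVec_ite_abs {θ : ℝ} (hθ : 0 ≤ θ) {T : Finset V} {P : V → Prop}
    [DecidablePred P] (hP : ∀ x y, G.Adj x y → x ∉ T → y ∉ T → P x → P y) {u : V → ℝ}
    (hu : G.adjMatrix ℝ *ᵥ u = θ • u) (huT : ∀ x ∈ T, u x = 0) (x : V) :
    θ * (if P x then |u x| else 0) ≤ (G.adjMatrix ℝ *ᵥ fun y => if P y then |u y| else 0) x := by
  rw [adjMatrix_mulVec_apply]
  by_cases hx : P x ∧ x ∉ T
  · have h1 := congrFun hu x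
    rw [adjMatrix_mulVec_apply] at h1
    have h2 : θ * |u x| = |(θ • u) x| := by
      rw [Pi.smul_apply, smul_eq_mul, abs_mul, abs_of_nonneg hθ]
    rw [if_pos hx.1, h2, ← h1]
    refine (Finset.abs_sum_le_sum_abs _ _).trans (Finset.sum_le_sum fun y hy => ?_)
    by_cases hy' : y ∈ T
    · simp [huT y hy']
    · rw [if_pos (hP x y (by simpa using hy) hx.2 hy' hx.1)]
  · have h0 : (if P x then |u x| else 0) = 0 := by
      split_ifs with h
      · rw [huT x (by tauto), abs_zero]
      · rfl
    rw [h0, mul_zero]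
    exact Finset.sum_nonneg fun y _ => by split_ifs <;> positivity

/-- If `θ` satisfies the extremality condition of the second largest eigenvalue, and every
vertex has an eigenvector for `θ` vanishing there and on `T` but not on its neighbourhood, then
no two vertices outside `T` are separated by `T`. -/
lemma not_separated_of_eigenvectors {θ : ℝ} (hθ : 0 ≤ θ) {T : Finset V}
    (hmax : ∀ h : V → ℝ, ∑ x, h x = 0 → θ * (h ⬝ᵥ h) ≤ h ⬝ᵥ (G.adjMatrix ℝ *ᵥ h) →
      G.adjMatrix ℝ *ᵥ h = θ • h)
    (hex : ∀ c, ∃ u : V → ℝ, G.adjMatrix ℝ *ᵥ u = θ • u ∧ (∀ x ∈ T, u x = 0) ∧ u c = 0 ∧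
      ∃ y, G.Adj c y ∧ u y ≠ 0)
    {P : V → Prop} (hP : ∀ x y, G.Adj x y → x ∉ T → y ∉ T → (P x ↔ P y))
    {a b : V} (haT : a ∉ T) (hbT : b ∉ T) (ha : P a) : P b := by
  classical
  by_contra hb
  obtain ⟨u, hu, huT, hua, y, hay, huy⟩ := hex a
  obtain ⟨v, hv, hvT, -, z, hbz, hvz⟩ := hex b
  have hyT : y ∉ T := fun h => huy (huT y h)
  have hzT : z ∉ T := fun h => hvz (hvT z h)
  have hPy : P y := (hP a y hay haT hyT).1 ha
  have hPz : ¬ P z := fun h => hb ((hP b z hbz hbT hzT).2 h)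
  set f : V → ℝ := fun x => if P x then |u x| else 0 with hf
  set g : V → ℝ := fun x => if ¬ P x then |v x| else 0 with hg
  have hf0 : ∀ x, 0 ≤ f x := fun x => by simp only [hf]; split_ifs <;> positivity
  have hg0 : ∀ x, 0 ≤ g x := fun x => by simp only [hg]; split_ifs <;> positivity
  have hfsub : ∀ x, θ * f x ≤ (G.adjMatrix ℝ *ᵥ f) x :=
    smul_le_adjMatrix_mulVec_ite_abs hθ (fun x y h hx hy => (hP x y h hx hy).1) hu huT
  have hgsub : ∀ x, θ * g x ≤ (G.adjMatrix ℝ *ᵥ g) x :=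
    smul_le_adjMatrix_mulVec_ite_abs hθ (fun x y h hx hy => mt (hP x y h hx hy).2) hv hvT
  have hAg : ∀ x, x ∉ T → P x → (G.adjMatrix ℝ *ᵥ g) x = 0 := by
    intro x hx hPx
    rw [adjMatrix_mulVec_apply]
    refine Finset.sum_eq_zero fun w hw => ?_
    by_cases hwT : w ∈ T
    · simp [hg, hvT w hwT]
    · simp [hg, (hP x w (by simpa using hw) hx hwT).1 hPx]
  have hAf : ∀ x, x ∉ T → ¬ P x → (G.adjMatrix ℝ *ᵥ f) x = 0 := by
    intro x hx hPx
    rw [adjMatrix_mulVec_apply]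
    refine Finset.sum_eq_zero fun w hw => ?_
    by_cases hwT : w ∈ T
    · simp [hf, huT w hwT]
    · simp [hf, mt (hP x w (by simpa using hw) hx hwT).2 hPx]
  have hfpos : 0 < ∑ x, f x :=
    Finset.sum_pos' (fun x _ => hf0 x) ⟨y, mem_univ y, by simp [hf, hPy, huy]⟩
  have hgpos : 0 < ∑ x, g x :=
    Finset.sum_pos' (fun x _ => hg0 x) ⟨z, mem_univ z, by simp [hg, hPz, hvz]⟩
  set α := ∑ x, g x
  set β := ∑ x, f x with hβ
  have hAh : ∀ x, (G.adjMatrix ℝ *ᵥ (α • f - β • g)) x =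
      α * (G.adjMatrix ℝ *ᵥ f) x - β * (G.adjMatrix ℝ *ᵥ g) x := by
    intro x
    rw [mulVec_sub, mulVec_smul, mulVec_smul]
    rfl
  have heig := hmax (α • f - β • g)
    (by simp only [Pi.sub_apply, Pi.smul_apply, smul_eq_mul, Finset.sum_sub_distrib,
          ← Finset.mul_sum]; rw [← hβ]; ring)
    (by
      simp only [dotProduct, Finset.mul_sum]
      refine Finset.sum_le_sum fun x _ => ?_
      rw [hAh]
      simp only [Pi.sub_apply, Pi.smul_apply, smul_eq_mul]
      by_cases hxT : x ∈ T
      · simp [hf, hg, huT x hxT, hvT x hxT]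
      by_cases hPx : P x
      · rw [hAg x hxT hPx, show g x = 0 by simp [hg, hPx]]
        have := mul_le_mul_of_nonneg_left (hfsub x) (mul_nonneg (mul_self_nonneg α) (hf0 x))
        linarith
      · rw [hAf x hxT hPx, show f x = 0 by simp [hf, hPx]]
        have := mul_le_mul_of_nonneg_left (hgsub x) (mul_nonneg (mul_self_nonneg β) (hg0 x))
        linarith)
  have hzero := congrFun heig a
  rw [hAh, hAg a haT ha] at hzero
  have hfa : f a = 0 := by simp [hf, hua]
  have hga : g a = 0 := by simp [hg, ha]
  simp only [Pi.sub_apply, Pi.smul_apply, smul_eq_mul, hfa, hga, mul_zero, sub_zero,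
    mul_eq_zero, hgpos.ne', false_or] at hzero
  rw [adjMatrix_mulVec_apply, Finset.sum_eq_zero_iff_of_nonneg fun x _ => hf0 x] at hzero
  have := hzero y (by simpa using hay)
  simp [hf, hPy, huy] at this

/-- If an eigenmatrix `N` for `θ` is of the form `(r - s) I + s J` on a clique larger than `S`,
then some eigenvector for `θ` vanishes on `S` but not on the whole clique. -/
lemma exists_eigenvector_of_isClique {θ r s : ℝ} {N : Matrix V V ℝ}
    (hN : G.adjMatrix ℝ * N = θ • N) (hdiag : ∀ x, N x x = r)
    (hedge : ∀ x y, G.Adj x y → N x y = s) (hs : 0 ≤ s) (hsr : s < r)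
    {K S : Finset V} (hK : G.IsClique (K : Set V)) (hcard : S.card < K.card) :
    ∃ u : V → ℝ, G.adjMatrix ℝ *ᵥ u = θ • u ∧ (∀ x ∈ S, u x = 0) ∧ ∃ y ∈ K, u y ≠ 0 := by
  obtain ⟨w, hw0, hw⟩ := (N.submatrix (Subtype.val : S → V) (Subtype.val : K → V)).mulVecLin.ker
    |>.ne_bot_iff.1 (LinearMap.ker_ne_bot_of_finrank_lt (by simpa using hcard))
  have hval : ∀ x, (N *ᵥ fun y => if h : y ∈ K then w ⟨y, h⟩ else 0) x = ∑ y : K, N x y * w y := by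
    intro x
    rw [mulVec, dotProduct, ← Finset.sum_subset (Finset.subset_univ K), ← Finset.sum_coe_sort]
    · simp
    · intro y _ hy
      simp [hy]
  refine ⟨N *ᵥ fun y => if h : y ∈ K then w ⟨y, h⟩ else 0, ?_, fun x hx => ?_, ?_⟩
  · rw [mulVec_mulVec, hN, smul_mulVec]
  · rw [hval]
    exact congrFun (LinearMap.mem_ker.1 hw0) ⟨x, hx⟩
  · by_contra! hzero
    have hK' : ∀ x : K, (r - s) * w x + s * ∑ y, w y = 0 := by
      intro x
      rw [← hzero x x.2, hval, Finset.mul_sum, ← Finset.add_sum_erase _ _ (mem_univ x),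
        ← Finset.add_sum_erase _ _ (mem_univ x), hdiag, ← add_assoc, ← add_mul, sub_add_cancel]
      congr 1
      refine Finset.sum_congr rfl fun y hy => ?_
      rw [hedge x y (hK x.2 y.2 fun h => (Finset.ne_of_mem_erase hy) (Subtype.ext h.symm))]
    have hsq : (r - s) * ∑ x, w x * w x + s * ((∑ y, w y) * ∑ y, w y) = 0 := by
      have : ∑ x, ((r - s) * w x + s * ∑ y, w y) * w x = 0 :=
        Finset.sum_eq_zero fun x _ => by rw [hK' x, zero_mul]
      simp only [add_mul, Finset.sum_add_distrib, mul_assoc] at this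
      rw [← Finset.mul_sum, ← Finset.mul_sum, ← Finset.mul_sum] at this
      exact this
    have hself : w ⬝ᵥ w = 0 := by
      have h1 : 0 ≤ w ⬝ᵥ w := Finset.sum_nonneg fun i _ => mul_self_nonneg _
      have h2 := mul_nonneg hs (mul_self_nonneg (∑ y, w y))
      rw [dotProduct] at *
      nlinarith
    exact hw (dotProduct_self_eq_zero.1 hself)

end SimpleGraph

namespace Matrix

variable {V : Type*} [Fintype V] [DecidableEq V]

/-- An eigenvalue of `A` has a nonzero eigenmatrix that is a polynomial in `A`. -/
lemma exists_aeval_ne_zero_mul_eq_smul (A : Matrix V V ℝ) {θ : ℝ} {v : V → ℝ} (hv : v ≠ 0)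
    (hAv : A *ᵥ v = θ • v) :
    ∃ q : Polynomial ℝ, Polynomial.aeval A q ≠ 0 ∧
      A * Polynomial.aeval A q = θ • Polynomial.aeval A q := by
  have hint : IsIntegral ℝ A := Algebra.IsIntegral.isIntegral A
  have hroot : (minpoly ℝ A).IsRoot θ := by
    have h1 : Module.End.HasEigenvalue (Matrix.toLin' A) θ :=
      Module.End.hasEigenvalue_of_hasEigenvector
        (Module.End.hasEigenvector_iff.2 ⟨Module.End.mem_eigenspace_iff.2 (by simpa using hAv), hv⟩)
    rw [← Matrix.minpoly_toLin']
    exact Module.End.isRoot_of_hasEigenvalue h1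
  obtain ⟨q, hq⟩ := Polynomial.dvd_iff_isRoot.2 hroot
  refine ⟨q, fun h0 => ?_, ?_⟩
  · have hne := minpoly.ne_zero hint
    have hq0 : q ≠ 0 := by
      rintro rfl
      exact hne (by rw [hq, mul_zero])
    have hdeg := Polynomial.natDegree_le_of_dvd (minpoly.dvd ℝ A h0) hq0
    rw [hq, Polynomial.natDegree_mul (Polynomial.X_sub_C_ne_zero θ) hq0,
      Polynomial.natDegree_X_sub_C] at hdeg
    omega
  · have h1 := minpoly.aeval ℝ A
    rw [hq, map_mul, map_sub, Polynomial.aeval_X, Polynomial.aeval_C, sub_mul, sub_eq_zero] at h1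
    rw [h1, Algebra.smul_def]

end Matrix

section AssociationScheme

variable {X ι : Type*} [Fintype X] [DecidableEq X] [Fintype ι]

/-- The Bose–Mesner algebra: matrices that are constant on the relations of a scheme. -/
def boseMesnerAlgebra (R : ι → X → X → Prop) (o : ι) (hR0 : ∀ x y, R o x y ↔ x = y)
    (hpart : ∀ x y : X, ∃! i, R i x y) (p : ι → ι → ι → ℕ)
    (hp : ∀ i j k x y, R k x y → {z : X | R i x z ∧ R j z y}.ncard = p i j k) :
    Subalgebra ℝ (Matrix X X ℝ) where
  carrier := {M | ∃ f : ι → ℝ, ∀ i x y, R i x y → M x y = f i}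
  mul_mem' := by
    classical
    rintro M N ⟨f, hf⟩ ⟨g, hg⟩
    refine ⟨fun k => ∑ i, ∑ j, p i j k * (f i * g j), fun k x y hk => ?_⟩
    have hz : ∀ z, M x z * N z y = ∑ i, ∑ j, if R i x z ∧ R j z y then f i * g j else 0 := by
      intro z
      obtain ⟨i, hi, hi'⟩ := hpart x z
      obtain ⟨j, hj, hj'⟩ := hpart z y
      rw [Finset.sum_eq_single i, Finset.sum_eq_single j]
      · rw [if_pos ⟨hi, hj⟩, hf i x z hi, hg j z y hj]
      · intro j₁ _ h
        exact if_neg fun h1 => h (hj' _ h1.2)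
      · simp
      · intro i₁ _ h
        exact Finset.sum_eq_zero fun j _ => if_neg fun h1 => h (hi' _ h1.1)
      · simp
    rw [mul_apply, Finset.sum_congr rfl fun z _ => hz z, Finset.sum_comm]
    refine Finset.sum_congr rfl fun i _ => ?_
    rw [Finset.sum_comm]
    refine Finset.sum_congr rfl fun j _ => ?_
    rw [← Finset.sum_filter, Finset.sum_const, nsmul_eq_mul, ← hp i j k x y hk,
      Set.ncard_eq_toFinset_card', Set.toFinset_ofPred]
  add_mem' := by
    rintro M N ⟨f, hf⟩ ⟨g, hg⟩
    exact ⟨f + g, fun i x y h => by simp [hf i x y h, hg i x y h]⟩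
  algebraMap_mem' := by
    classical
    intro r
    refine ⟨fun i => if i = o then r else 0, fun i x y h => ?_⟩
    have hio : i = o ↔ x = y := by
      rw [← hR0]
      exact ⟨fun h1 => h1 ▸ h, fun h1 => (hpart x y).unique h h1⟩
    simp [algebraMap_matrix_apply, hio]

/-- An eigenvalue `θ` of a basis relation `R e` of a symmetric scheme has an eigenmatrix in
the Bose–Mesner algebra with positive diagonal. -/
lemma exists_eigenmatrix_of_scheme (R : ι → X → X → Prop) (o e : ι)
    (hR0 : ∀ x y, R o x y ↔ x = y)
    (hpart : ∀ x y : X, ∃! i, R i x y) (hsym : ∀ i x y, R i x y → R i y x) (p : ι → ι → ι → ℕ)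
    (hp : ∀ i j k x y, R k x y → {z : X | R i x z ∧ R j z y}.ncard = p i j k)
    (G : SimpleGraph X) [DecidableRel G.Adj] (hG : ∀ x y, G.Adj x y ↔ R e x y)
    {θ : ℝ} {v : X → ℝ} (hv : v ≠ 0) (hAv : G.adjMatrix ℝ *ᵥ v = θ • v) :
    ∃ (N : Matrix X X ℝ) (r s : ℝ), G.adjMatrix ℝ * N = θ • N ∧ (∀ x, N x x = r) ∧
      (∀ x y, G.Adj x y → N x y = s) ∧ 0 < r := by
  classical
  set 𝔄 := boseMesnerAlgebra R o hR0 hpart p hp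
  have hA : G.adjMatrix ℝ ∈ 𝔄 := by
    refine ⟨fun i => if i = e then 1 else 0, fun i x y h => ?_⟩
    have hie : i = e ↔ R e x y := ⟨fun h1 => h1 ▸ h, fun h1 => (hpart x y).unique h h1⟩
    simp [SimpleGraph.adjMatrix_apply, hie, hG]
  obtain ⟨q, hq0, hq⟩ := exists_aeval_ne_zero_mul_eq_smul _ hv hAv
  set M := Polynomial.aeval (G.adjMatrix ℝ) q
  have hM : M ∈ 𝔄 :=
    Algebra.adjoin_le (Set.singleton_subset_iff.2 hA) (Polynomial.aeval_mem_adjoin_singleton ℝ _)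
  obtain ⟨f, hf⟩ := hM
  obtain ⟨g, hg⟩ := 𝔄.mul_mem ⟨f, hf⟩ ⟨f, hf⟩
  have hsymm : ∀ x y, M x y = M y x := by
    intro x y
    obtain ⟨i, hi, -⟩ := hpart x y
    rw [hf i x y hi, hf i y x (hsym i x y hi)]
  have hdiag : ∀ x, (M * M) x x = g o := fun x => hg o x x ((hR0 x x).2 rfl)
  refine ⟨M * M, g o, g e, ?_, hdiag, fun x y h => hg e x y ((hG x y).1 h), ?_⟩
  · rw [← mul_assoc, hq, smul_mul_assoc]
  · obtain ⟨x, y, hxy⟩ : ∃ x y, M x y ≠ 0 := by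
      by_contra! h
      exact hq0 (Matrix.ext h)
    rw [← hdiag x, mul_apply]
    refine Finset.sum_pos' (fun z _ => ?_) ⟨y, mem_univ y, ?_⟩
    · rw [hsymm z x]
      exact mul_self_nonneg _
    · rw [hsymm y x]
      exact mul_self_pos.2 hxy

end AssociationScheme

namespace SimpleGraph

/-- In a graph without induced `K_{2,1,1}`, an edge together with its common neighbours is a
clique. -/
lemma isClique_insert_insert_commonNeighbors {V : Type*} {G : SimpleGraph V}
    (hfree : ¬ ∃ a b c e : V, a ≠ b ∧ ¬G.Adj a b ∧
        G.Adj a c ∧ G.Adj a e ∧ G.Adj b c ∧ G.Adj b e ∧ G.Adj c e) {c e : V} (hce : G.Adj c e) :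
    G.IsClique (insert c (insert e (G.commonNeighbors c e))) := by
  simp only [isClique_insert, Set.mem_insert_iff, mem_commonNeighbors]
  refine ⟨⟨fun a ha b hb hab => ?_, fun b hb _ => hb.2⟩, ?_⟩
  · rw [mem_commonNeighbors] at ha hb
    by_contra h
    exact hfree ⟨a, b, c, e, hab, h, ha.1.symm, ha.2.symm, hb.1.symm, hb.2.symm, hce⟩
  · rintro b (rfl | hb) _
    · exact hce
    · exact hb.1

end SimpleGraph

/-- Spectral lemma: if the connected basis relation `Γ = Γ(X, R_1)` of a symmetric
association scheme contains no induced `K_{2,1,1}` (i.e. `K₄` minus an edge), then every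
disconnecting set `T` of `Γ` satisfies `|T| > p¹₁₁`. -/
theorem stmt_19 (X : Type) [Fintype X] (d : ℕ) (hd : 1 ≤ d)
    (R : Fin (d + 1) → X → X → Prop)
    (hR0 : ∀ x y, R 0 x y ↔ x = y)
    (hpart : ∀ x y : X, ∃! i, R i x y)
    (hsym : ∀ i x y, R i x y → R i y x)
    (p : Fin (d + 1) → Fin (d + 1) → Fin (d + 1) → ℕ)
    (hp : ∀ i j k x y, R k x y → {z : X | R i x z ∧ R j z y}.ncard = p i j k)
    (Γ : SimpleGraph X) (hΓ : ∀ x y, Γ.Adj x y ↔ x ≠ y ∧ R 1 x y)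
    (hconn : Γ.Connected)
    (hfree : ¬ ∃ a b c e : X, a ≠ b ∧ ¬Γ.Adj a b ∧
        Γ.Adj a c ∧ Γ.Adj a e ∧ Γ.Adj b c ∧ Γ.Adj b e ∧ Γ.Adj c e)
    (T : Finset X)
    (hdisc : ¬ (Γ.induce ((↑T : Set X)ᶜ)).Preconnected) :
    p 1 1 1 < T.card := by
  classical
  by_contra! hT
  have h10 : (1 : Fin (d + 1)) ≠ 0 := by
    rw [Ne, Fin.ext_iff, Fin.val_one', Fin.val_zero, Nat.mod_eq_of_lt (by omega)]
    exact one_ne_zero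
  have hadj : ∀ x y, Γ.Adj x y ↔ R 1 x y := by
    intro x y
    rw [hΓ, and_iff_right_iff_imp]
    rintro h rfl
    exact h10 ((hpart x x).unique h ((hR0 x x).2 rfl))
  have hreg : Γ.IsRegularOfDegree (p 1 1 0) := by
    intro x
    rw [← hp 1 1 0 x x ((hR0 x x).2 rfl), ← SimpleGraph.card_neighborFinset_eq_degree,
      ← Set.ncard_coe_finset]
    congr 1
    ext z
    simp only [SimpleGraph.coe_neighborFinset, SimpleGraph.mem_neighborSet, Set.mem_ofPred_eq, hadj]
    exact ⟨fun h => ⟨h, hsym _ _ _ h⟩, fun h => h.1⟩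
  rw [SimpleGraph.Preconnected] at hdisc
  push Not at hdisc
  obtain ⟨⟨a, haT⟩, ⟨b, hbT⟩, hab⟩ := hdisc
  have hne : a ≠ b := by
    rintro rfl
    exact hab (SimpleGraph.Reachable.refl _)
  have hnadj : ¬ Γ.Adj a b := fun h => hab (SimpleGraph.Adj.reachable (by simpa using h))
  obtain ⟨θ, hθ0, hθk, ⟨v, hv, hAv⟩, hmax⟩ := hconn.exists_second_eigenvalue hreg hne hnadj
  obtain ⟨N, r, s, hN, hdiag, hedge, hr⟩ :=
    exists_eigenmatrix_of_scheme R 0 1 hR0 hpart hsym p hp Γ hadj hv hAv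
  have hks : (p 1 1 0 : ℝ) * s = θ * r := by
    have h1 := congrFun (congrFun hN a) a
    rw [SimpleGraph.adjMatrix_mul_apply, Matrix.smul_apply, hdiag, smul_eq_mul,
      Finset.sum_congr rfl fun y hy => hedge y a (by simpa using hy : Γ.Adj a y).symm,
      Finset.sum_const, SimpleGraph.card_neighborFinset_eq_degree, hreg.degree_eq,
      nsmul_eq_mul] at h1
    exact h1
  have hk : (0 : ℝ) < p 1 1 0 := hθ0.trans_lt hθk
  have hs : 0 ≤ s := nonneg_of_mul_nonneg_right (hks ▸ mul_nonneg hθ0 hr.le) hk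
  have hsr : s < r := by
    refine lt_of_mul_lt_mul_left ?_ hk.le
    rw [hks]
    exact mul_lt_mul_of_pos_right hθk hr
  have hex : ∀ c, ∃ u : X → ℝ, Γ.adjMatrix ℝ *ᵥ u = θ • u ∧ (∀ x ∈ T, u x = 0) ∧ u c = 0 ∧
      ∃ y, Γ.Adj c y ∧ u y ≠ 0 := by
    intro c
    obtain ⟨e, hce⟩ : ∃ e, Γ.Adj c e := by
      rw [← Γ.degree_pos_iff_exists_adj c, hreg.degree_eq]
      exact_mod_cast hk
    set K : Finset X := insert c (insert e (Γ.commonNeighbors c e).toFinset) with hKdef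
    have hK : Γ.IsClique (K : Set X) := by
      simpa [hKdef] using SimpleGraph.isClique_insert_insert_commonNeighbors hfree hce
    have hcardK : K.card = p 1 1 1 + 2 := by
      have hcn : (Γ.commonNeighbors c e).toFinset.card = p 1 1 1 := by
        rw [← hp 1 1 1 c e ((hadj c e).1 hce), ← Set.ncard_eq_toFinset_card']
        congr 1
        ext z
        rw [SimpleGraph.mem_commonNeighbors, Γ.adj_comm e z, hadj, hadj]
        rfl
      rw [hKdef, Finset.card_insert_of_notMem, Finset.card_insert_of_notMem, hcn]
      · simp [SimpleGraph.mem_commonNeighbors]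
      · simp [SimpleGraph.mem_commonNeighbors, hce.ne]
    obtain ⟨u, hu, hu0, y, hyK, hy⟩ := SimpleGraph.exists_eigenvector_of_isClique hN hdiag hedge
      hs hsr hK (S := insert c T) (by have := Finset.card_insert_le c T; omega)
    have huc : u c = 0 := hu0 c (mem_insert_self c T)
    refine ⟨u, hu, fun x hx => hu0 x (mem_insert_of_mem hx), huc, y, ?_, hy⟩
    refine hK (by simp [hKdef]) hyK ?_
    rintro rfl
    exact hy huc
  obtain ⟨hb, hreach⟩ := SimpleGraph.not_separated_of_eigenvectors hθ0 hmax hex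
    (P := fun x => ∃ h : x ∈ ((↑T : Set X)ᶜ), (Γ.induce ((↑T : Set X)ᶜ)).Reachable ⟨a, haT⟩ ⟨x, h⟩)
    (fun x y hxy hx hy => by
      have hadj' : (Γ.induce ((↑T : Set X)ᶜ)).Adj ⟨x, by simpa using hx⟩ ⟨y, by simpa using hy⟩ := by
        simpa using hxy
      exact ⟨fun ⟨_, h⟩ => ⟨by simpa using hy, h.trans hadj'.reachable⟩,
        fun ⟨_, h⟩ => ⟨by simpa using hx, h.trans hadj'.symm.reachable⟩⟩)
    (by simpa using haT) (by simpa using hbT) ⟨haT, SimpleGraph.Reachable.refl _⟩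
  exact hab hreach
end
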